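/- Let δ > 0 and let Q be an n×n quaternion Hermitian matrix with max_{i≠j} |Q_{ij}| ≤ δ. Let μ₁, …, μ_n be pairwise distinct real numbers and v₁, …, v_n quaternion vectors with Q v_i = μ_i v_i, ‖v_i‖ = 1, and (v_i)_i ≠ 0 for each i, and suppose the matching condition Σ_{i=1}^n (μ_i − Q_{ii})² ≤ n(n−1) δ² holds. Let c = min_{i≠j} |μ_i − μ_j| and suppose c ≥ 2√(n(n−1)) δ. Let V be the n×n quaternion matrix whose i-th column is v_i · ((v_i)_i)*/|(v_i)_i|. Then max_{1≤i,j≤n} |(I − V)_{ij}| ≤ 2δ/c. -/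

import Mathlib

open Matrix

noncomputable section

lemma quat_self_mul_star (q : Quaternion ℝ) : q * star q = ((‖q‖ ^ 2 : ℝ) : Quaternion ℝ) := by
  rw [Quaternion.self_mul_star, Quaternion.normSq_eq_norm_mul_self, sq]

lemma quat_star_mul_self (q : Quaternion ℝ) : star q * q = ((‖q‖ ^ 2 : ℝ) : Quaternion ℝ) := by
  rw [Quaternion.star_mul_self, Quaternion.normSq_eq_norm_mul_self, sq]

lemma quat_coe_sum {ι : Type*} (s : Finset ι) (f : ι → ℝ) :
    ((∑ i ∈ s, f i : ℝ) : Quaternion ℝ) = ∑ i ∈ s, ((f i : ℝ) : Quaternion ℝ) :=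
  map_sum (algebraMap ℝ (Quaternion ℝ)) f s

/-- rows of the eigenvector matrix are orthonormal as well -/
lemma eig_unitary (n : ℕ) (Q : Matrix (Fin n) (Fin n) (Quaternion ℝ)) (μ : Fin n → ℝ)
    (v : Fin n → Fin n → Quaternion ℝ) (hQ : Qᴴ = Q)
    (hμ : ∀ i j, i ≠ j → μ i ≠ μ j)
    (heig : ∀ i, Q.mulVec (v i) = fun j => ((μ i : ℝ) : Quaternion ℝ) * v i j)
    (hnorm : ∀ i, ∑ j, ‖v i j‖ ^ 2 = 1) :
    (Matrix.of fun j i => v i j) * (Matrix.of fun j i => v i j)ᴴ = 1 := by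
  set U : Matrix (Fin n) (Fin n) (Quaternion ℝ) := Matrix.of fun j i => v i j with hU
  set D : Matrix (Fin n) (Fin n) (Quaternion ℝ) :=
    Matrix.diagonal fun i => ((μ i : ℝ) : Quaternion ℝ) with hD
  have hQU : Q * U = U * D := by
    ext1 j i
    have := congrFun (heig i) j
    rw [hD, Matrix.mul_diagonal, ← Quaternion.coe_commutes]
    exact this
  have hDs : Dᴴ = D := by
    rw [hD, Matrix.diagonal_conjTranspose]
    congr 1
    ext1 i
    simp
  have h2 : Uᴴ * Q = D * Uᴴ := by
    have := congrArg Matrix.conjTranspose hQU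
    rwa [Matrix.conjTranspose_mul, Matrix.conjTranspose_mul, hQ, hDs] at this
  have h3 : (Uᴴ * U) * D = D * (Uᴴ * U) := by
    rw [Matrix.mul_assoc, ← hQU, ← Matrix.mul_assoc, h2, Matrix.mul_assoc]
  have h4 : Uᴴ * U = 1 := by
    ext1 i k
    by_cases hik : i = k
    · subst hik
      rw [Matrix.one_apply_eq, Matrix.mul_apply]
      simp only [Matrix.conjTranspose_apply, hU, Matrix.of_apply, quat_star_mul_self]
      rw [← quat_coe_sum, hnorm]
      simp
    · rw [Matrix.one_apply_ne hik]
      have h5 := congrFun (congrFun h3 i) k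
      rw [hD, Matrix.mul_diagonal, Matrix.diagonal_mul, ← Quaternion.coe_commutes,
        ← sub_eq_zero, ← sub_mul, mul_eq_zero] at h5
      rcases h5 with h5 | h5
      · exfalso
        rw [sub_eq_zero, Quaternion.coe_inj] at h5
        exact hμ i k hik h5.symm
      · exact h5
  exact mul_eq_one_comm.mp h4

lemma eig_rows (n : ℕ) (Q : Matrix (Fin n) (Fin n) (Quaternion ℝ)) (μ : Fin n → ℝ)
    (v : Fin n → Fin n → Quaternion ℝ)
    (heig : ∀ i, Q.mulVec (v i) = fun j => ((μ i : ℝ) : Quaternion ℝ) * v i j) (i j : Fin n) :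
    (((μ i : ℝ) : Quaternion ℝ) - Q j j) * v i j = ∑ k ∈ Finset.univ.erase j, Q j k * v i k := by
  have := congrFun (heig i) j
  simp only [Matrix.mulVec, dotProduct] at this
  rw [sub_mul, ← this, ← Finset.add_sum_erase _ _ (Finset.mem_univ j)]
  simp

/-- right multiplication by a unitary preserves row norms -/
lemma row_norm (n : ℕ) (U B : Matrix (Fin n) (Fin n) (Quaternion ℝ)) (hU : U * Uᴴ = 1)
    (j : Fin n) : ∑ i, ‖(B * U) j i‖ ^ 2 = ∑ k, ‖B j k‖ ^ 2 := by
  have h : (B * U) * (B * U)ᴴ = B * Bᴴ := by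
    rw [Matrix.conjTranspose_mul, Matrix.mul_assoc, ← Matrix.mul_assoc U, hU, Matrix.one_mul]
  have h2 := congrFun (congrFun h j) j
  rw [Matrix.mul_apply (M := B * U), Matrix.mul_apply (M := B)] at h2
  simp only [Matrix.conjTranspose_apply, quat_self_mul_star] at h2
  rw [← quat_coe_sum, ← quat_coe_sum, Quaternion.coe_inj] at h2
  exact h2

theorem eigenvector_matrix_close_to_identity (n : ℕ) (δ c : ℝ) (hδ : 0 < δ)
    (Q : Matrix (Fin n) (Fin n) (Quaternion ℝ)) (μ : Fin n → ℝ)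
    (v : Fin n → Fin n → Quaternion ℝ)
    (hQ : Qᴴ = Q)
    (hoff : ∀ i j, i ≠ j → ‖Q i j‖ ≤ δ)
    (hμ : ∀ i j, i ≠ j → μ i ≠ μ j)
    (heig : ∀ i, Q.mulVec (v i) = fun j => ((μ i : ℝ) : Quaternion ℝ) * v i j)
    (hnorm : ∀ i, ∑ j, ‖v i j‖ ^ 2 = 1)
    (hvi : ∀ i, v i i ≠ 0)
    (hmatch : ∑ i, ‖((μ i : ℝ) : Quaternion ℝ) - Q i i‖ ^ 2 ≤ (n : ℝ) * ((n : ℝ) - 1) * δ ^ 2)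
    (hclb : ∀ i j, i ≠ j → c ≤ |μ i - μ j|)
    (hcmin : ∃ i j, i ≠ j ∧ c = |μ i - μ j|)
    (hc : 2 * Real.sqrt ((n : ℝ) * ((n : ℝ) - 1)) * δ ≤ c) :
    ∀ i j, ‖((1 : Matrix (Fin n) (Fin n) (Quaternion ℝ)) -
        Matrix.of fun j i => v i j * (star (v i i) / ((‖v i i‖ : ℝ) : Quaternion ℝ))) i j‖
      ≤ 2 * δ / c := by
  have hU := eig_unitary n Q μ v hQ hμ heig hnorm
  have hkey := eig_rows n Q μ v heig
  have hn2 : 2 ≤ n := by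
    obtain ⟨i, j, hij, -⟩ := hcmin
    have := i.2
    have := j.2
    have : (i : ℕ) ≠ j := fun h => hij (Fin.ext h)
    omega
  have hnR : (2 : ℝ) ≤ n := by exact_mod_cast hn2
  obtain ⟨s, hs⟩ : ∃ s, s = Real.sqrt ((n : ℝ) * ((n : ℝ) - 1)) := ⟨_, rfl⟩
  rw [← hs] at hc
  have hs0 : 0 ≤ s := hs ▸ Real.sqrt_nonneg _
  have hs2 : s ^ 2 = n * (n - 1) := by
    rw [hs, Real.sq_sqrt]
    nlinarith
  have hsn1 : (n : ℝ) - 1 ≤ s := by nlinarith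
  have hsn : s ≤ n := by nlinarith
  have hspos : 0 < s := by linarith
  have hcpos : 0 < c := by nlinarith [mul_pos hspos hδ]
  have hcard : ∀ j : Fin n, ((Finset.univ.erase j).card : ℝ) = n - 1 := by
    intro j
    rw [Finset.card_erase_of_mem (Finset.mem_univ j), Finset.card_univ, Fintype.card_fin,
      Nat.cast_sub (by omega)]
    simp
  -- row norms
  have hrow1 : ∀ j, ∑ i, ‖v i j‖ ^ 2 = 1 := by
    intro j
    have h := row_norm n _ 1 hU j
    rw [Matrix.one_mul] at h
    simp only [Matrix.of_apply] at h
    rw [h, ← Finset.add_sum_erase _ _ (Finset.mem_univ j), Finset.sum_eq_zero]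
    · simp
    · intro k hk
      rw [Matrix.one_apply_ne (Finset.ne_of_mem_erase hk).symm]
      simp
  have hrow2 : ∀ j, ∑ i, (‖((μ i : ℝ) : Quaternion ℝ) - Q j j‖ * ‖v i j‖) ^ 2
      ≤ ((n : ℝ) - 1) * δ ^ 2 := by
    intro j
    have h := row_norm n _ (Matrix.of fun a b => if b = a then 0 else Q a b) hU j
    have h1 : ∀ i, (((Matrix.of fun a b => if b = a then 0 else Q a b) : Matrix _ _ _) *
        (Matrix.of fun j i => v i j)) j i = (((μ i : ℝ) : Quaternion ℝ) - Q j j) * v i j := by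
      intro i
      rw [hkey, Matrix.mul_apply, ← Finset.add_sum_erase _ _ (Finset.mem_univ j)]
      simp only [Matrix.of_apply, if_true, zero_mul, zero_add]
      refine Finset.sum_congr rfl fun k hk => ?_
      rw [if_neg (Finset.ne_of_mem_erase hk)]
    simp only [h1, norm_mul] at h
    rw [h, ← Finset.add_sum_erase _ _ (Finset.mem_univ j)]
    simp only [Matrix.of_apply, if_true, norm_zero]
    rw [← hcard j, ← nsmul_eq_mul, ← Finset.sum_const]
    norm_num only [zero_add]
    refine Finset.sum_le_sum fun k hk => ?_
    have hkj := Finset.ne_of_mem_erase hk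
    rw [if_neg hkj]
    exact pow_le_pow_left₀ (norm_nonneg _) (hoff j k hkj.symm) 2
  have hrowb : ∀ (b : ℝ) (j : Fin n), 0 ≤ b →
      (∀ i, i ≠ j → b ≤ ‖((μ i : ℝ) : Quaternion ℝ) - Q j j‖) →
      b ^ 2 * (1 - ‖v j j‖ ^ 2) ≤ ((n : ℝ) - 1) * δ ^ 2 := by
    intro b j hb h
    refine le_trans ?_ (hrow2 j)
    rw [← hrow1 j, ← Finset.add_sum_erase _ _ (Finset.mem_univ j), add_sub_cancel_left,
      Finset.mul_sum, ← Finset.add_sum_erase _ _ (Finset.mem_univ j)]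
    refine le_add_of_nonneg_of_le (sq_nonneg _) (Finset.sum_le_sum fun i hi => ?_)
    rw [← mul_pow]
    have := h i (Finset.ne_of_mem_erase hi)
    gcongr
  -- gap
  have hgap : ∀ (m : ℝ) (i j : Fin n), i ≠ j → ‖((μ j : ℝ) : Quaternion ℝ) - Q j j‖ ≤ m →
      c - m ≤ ‖((μ i : ℝ) : Quaternion ℝ) - Q j j‖ := by
    intro m i j hij hm
    have h1 := hclb i j hij
    have h2 : ‖((μ i : ℝ) : Quaternion ℝ) - ((μ j : ℝ) : Quaternion ℝ)‖ = |μ i - μ j| := by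
      rw [← Quaternion.coe_sub, Quaternion.norm_coe, Real.norm_eq_abs]
    have h3 := norm_sub_le_norm_sub_add_norm_sub ((μ i : ℝ) : Quaternion ℝ) (Q j j)
      ((μ j : ℝ) : Quaternion ℝ)
    rw [norm_sub_rev (Q j j)] at h3
    linarith
  have hm1 : ∀ j, ‖((μ j : ℝ) : Quaternion ℝ) - Q j j‖ ≤ s * δ := by
    intro j
    have h := (Finset.single_le_sum (f := fun i => ‖((μ i : ℝ) : Quaternion ℝ) - Q i i‖ ^ 2)
      (fun i _ => sq_nonneg _) (Finset.mem_univ j)).trans hmatch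
    rw [← hs2, ← mul_pow] at h
    exact (pow_le_pow_iff_left₀ (norm_nonneg _) (by positivity) two_ne_zero).mp h
  have hX1 : ∀ j, n * (1 - ‖v j j‖ ^ 2) ≤ 1 := by
    intro j
    have h := hrowb (s * δ) j (by positivity) (fun i hi => by
      have := hgap _ i j hi (hm1 j)
      linarith)
    rw [mul_pow, hs2] at h
    have h0 : 0 < ((n : ℝ) - 1) * δ ^ 2 := mul_pos (by linarith) (by positivity)
    refine le_of_mul_le_mul_left ?_ h0
    linarith
  have hX1c : ∀ j, c ^ 2 * (1 - ‖v j j‖ ^ 2) ≤ 4 * ((n : ℝ) - 1) * δ ^ 2 := by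
    intro j
    have h := hrowb (c / 2) j (by positivity) (fun i hi => by
      have := hgap _ i j hi (hm1 j)
      linarith)
    linarith
  have hcol : ∀ j, ∑ k ∈ Finset.univ.erase j, ‖v j k‖ ^ 2 = 1 - ‖v j j‖ ^ 2 := by
    intro j
    rw [← hnorm j, ← Finset.add_sum_erase _ _ (Finset.mem_univ j), add_sub_cancel_left]
  have hA1 : ∀ j, ‖v j j‖ ≤ 1 := by
    intro j
    have : 0 ≤ 1 - ‖v j j‖ ^ 2 := hcol j ▸ Finset.sum_nonneg fun _ _ => sq_nonneg _
    nlinarith [norm_nonneg (v j j)]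
  have hkeyn : ∀ i j, ‖((μ i : ℝ) : Quaternion ℝ) - Q j j‖ * ‖v i j‖
      ≤ δ * ∑ k ∈ Finset.univ.erase j, ‖v i k‖ := by
    intro i j
    rw [← norm_mul, hkey, Finset.mul_sum]
    refine norm_sum_le_of_le _ fun k hk => ?_
    rw [norm_mul]
    have := hoff j k (Finset.ne_of_mem_erase hk).symm
    gcongr
  have hm2 : ∀ j, ‖((μ j : ℝ) : Quaternion ℝ) - Q j j‖ ≤ δ := by
    intro j
    have h := hkeyn j j
    have h1 := sq_sum_le_card_mul_sum_sq (s := Finset.univ.erase j) (f := fun k => ‖v j k‖)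
    rw [hcard, hcol] at h1
    have hx := hX1 j
    have h2 := pow_le_pow_left₀ (by positivity) h 2
    rw [mul_pow, mul_pow] at h2
    have h3 : δ ^ 2 * (∑ k ∈ Finset.univ.erase j, ‖v j k‖) ^ 2 ≤ δ ^ 2 * ‖v j j‖ ^ 2 := by
      refine mul_le_mul_of_nonneg_left (h1.trans ?_) (by positivity)
      linarith
    have hA : 0 < ‖v j j‖ ^ 2 := by
      have := norm_pos_iff.mpr (hvi j)
      positivity
    have h4 := le_of_mul_le_mul_right (h2.trans h3) hA
    exact (pow_le_pow_iff_left₀ (norm_nonneg _) hδ.le two_ne_zero).mp h4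
  have hcd : (2 * s - 1) * δ ≤ c - δ := by linarith
  have h2s : 0 < 2 * s - 1 := by linarith
  have hX2 : ∀ j, (2 * s - 1) ^ 2 * (1 - ‖v j j‖ ^ 2) ≤ (n : ℝ) - 1 := by
    intro j
    have h := hrowb ((2 * s - 1) * δ) j (by positivity)
      (fun i hi => hcd.trans (hgap _ i j hi (hm2 j)))
    rw [mul_pow] at h
    refine le_of_mul_le_mul_left ?_ (show 0 < δ ^ 2 by positivity)
    linarith
  have hoffd : ∀ i j, i ≠ j → ‖v i j‖ ≤ 2 * δ / c := by
    intro i j hij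
    have h := hkeyn i j
    have hg := hgap _ i j hij (hm2 j)
    have hi : i ∈ Finset.univ.erase j := Finset.mem_erase.mpr ⟨hij, Finset.mem_univ _⟩
    rw [← Finset.add_sum_erase _ _ hi] at h
    obtain ⟨S, hS⟩ : ∃ S, S = ∑ k ∈ (Finset.univ.erase j).erase i, ‖v i k‖ := ⟨_, rfl⟩
    rw [← hS] at h
    have hcard2 : (((Finset.univ.erase j).erase i).card : ℝ) = n - 2 := by
      rw [Finset.card_erase_of_mem hi, Nat.cast_sub (Finset.card_pos.mpr ⟨i, hi⟩), hcard]
      push_cast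
      ring
    have hS0 : 0 ≤ S := hS ▸ Finset.sum_nonneg fun _ _ => norm_nonneg _
    have hS2 : S ^ 2 ≤ ((n : ℝ) - 2) * (1 - ‖v i i‖ ^ 2) := by
      have h1 := sq_sum_le_card_mul_sum_sq (s := (Finset.univ.erase j).erase i)
        (f := fun k => ‖v i k‖)
      rw [hcard2, ← hS] at h1
      refine h1.trans (mul_le_mul_of_nonneg_left ?_ (by linarith))
      rw [← hcol i]
      refine Finset.sum_le_sum_of_subset_of_nonneg ?_ fun _ _ _ => sq_nonneg _
      exact Finset.erase_subset_erase _ (Finset.erase_subset _ _)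
    have hbound : c * (1 + S) ≤ 2 * (c - δ) := by
      rcases Nat.lt_or_ge n 3 with h3 | h3
      · have : n = 2 := by omega
        subst this
        have : S = 0 := by
          norm_num at hS2
          exact hS2
        rw [this]
        nlinarith
      · have h3R : (3 : ℝ) ≤ n := by exact_mod_cast h3
        have hSh : S ≤ 1 / 2 := by
          have h1 : (2 * s - 1) ^ 2 * S ^ 2 ≤ ((n : ℝ) - 2) * (n - 1) := by
            have := mul_le_mul_of_nonneg_left (hX2 i) (show 0 ≤ (n : ℝ) - 2 by linarith)
            have := mul_le_mul_of_nonneg_left hS2 (show 0 ≤ (2 * s - 1) ^ 2 by positivity)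
            linarith
          have h2 : ((n : ℝ) - 2) * (n - 1) ≤ (2 * s - 1) ^ 2 * (1 / 2) ^ 2 := by nlinarith
          have h4 := le_of_mul_le_mul_left (h1.trans h2) (by positivity)
          exact (pow_le_pow_iff_left₀ hS0 (by norm_num) two_ne_zero).mp h4
        have h4 : 4 * δ ≤ c := by nlinarith
        nlinarith
    have hcd0 : 0 < c - δ := lt_of_lt_of_le (by positivity) hcd
    have h5 : (c - δ) * ‖v i j‖ ≤ δ * (1 + S) := by
      refine (mul_le_mul_of_nonneg_right hg (norm_nonneg _)).trans (h.trans ?_)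
      have := hA1 i
      gcongr
    rw [le_div_iff₀ hcpos]
    refine le_of_mul_le_mul_left ?_ hcd0
    calc (c - δ) * (‖v i j‖ * c) = c * ((c - δ) * ‖v i j‖) := by ring
      _ ≤ c * (δ * (1 + S)) := by gcongr
      _ = δ * (c * (1 + S)) := by ring
      _ ≤ δ * (2 * (c - δ)) := by gcongr
      _ = (c - δ) * (2 * δ) := by ring
  have hdiag : ∀ j, 1 - ‖v j j‖ ≤ 2 * δ / c := by
    intro j
    have h1 := hX1c j
    have h2 : 1 - ‖v j j‖ ≤ 1 - ‖v j j‖ ^ 2 := by nlinarith [hA1 j, norm_nonneg (v j j)]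
    refine h2.trans ?_
    rw [le_div_iff₀ hcpos]
    refine le_of_mul_le_mul_left ?_ hcpos
    have h3 : 2 * ((n : ℝ) - 1) * δ ≤ c := le_trans (by gcongr) hc
    nlinarith
  intro j i
  rw [Matrix.sub_apply, Matrix.of_apply]
  have hpos : ‖v i i‖ ≠ 0 := norm_ne_zero_iff.mpr (hvi i)
  by_cases hij : j = i
  · subst hij
    rw [Matrix.one_apply_eq, ← mul_div_assoc, quat_self_mul_star, ← Quaternion.coe_div,
      sq, mul_div_assoc, div_self hpos, mul_one, ← Quaternion.coe_one, ← Quaternion.coe_sub,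
      Quaternion.norm_coe, Real.norm_eq_abs, abs_of_nonneg (by linarith [hA1 j])]
    exact hdiag j
  · rw [Matrix.one_apply_ne hij, zero_sub, norm_neg, norm_mul, norm_div, norm_star,
      Quaternion.norm_coe, norm_norm, div_self hpos, mul_one]
    exact hoffd i j (Ne.symm hij)
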